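/- Let S ∈ {-1,0,+1}^d be a nonzero sign vector and let σ be a nonempty compact convex subset of C_S. Then a set B is a nonempty exposed face of the Minkowski sum □_S + S·σ if and only if B = □_T + S·τ for some sign vector T with S ≤ T and some nonempty exposed face τ of σ. -/

import Mathlib

open Pointwise

/-- The cube `□_d = [-1,1]^d ⊆ ℝ^d`. -/
def cube (d : ℕ) : Set (Fin d → ℝ) := {x | ∀ i, |x i| ≤ 1}

/-- The face `□_S` of the cube determined by the sign vector `S`. -/
def cubeFace {d : ℕ} (S : Fin d → SignType) : Set (Fin d → ℝ) :=
  {x | (∀ i, |x i| ≤ 1) ∧ ∀ i, S i ≠ 0 → x i = (S i : ℝ)}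

/-- The cone `C_S = {x : x i ≥ 0 for all i, x i = 0 for i ∉ supp S}`. -/
def cone {d : ℕ} (S : Fin d → SignType) : Set (Fin d → ℝ) :=
  {x | (∀ i, 0 ≤ x i) ∧ ∀ i, S i = 0 → x i = 0}

/-- The reflection `S·K` of a set `K ⊆ ℝ^d` into the orthant indicated by `S`. -/
def sdot {d : ℕ} (S : Fin d → SignType) (K : Set (Fin d → ℝ)) : Set (Fin d → ℝ) :=
  (fun x => fun i => (S i : ℝ) * x i) '' K

/-! Statement 19: for a nonzero sign vector `S` and a nonempty compact convex
`σ ⊆ C_S`, the nonempty exposed faces of `□_S + S·σ` are exactly the sets `□_T + S·τ`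
with `S ≤ T` and `τ` a nonempty exposed face of `σ`. -/

/-- The order on sign vectors: `S ≤ T` iff `S i = T i` for every `i` in the support of `S`. -/
def SVLe {d : ℕ} (S T : Fin d → SignType) : Prop := ∀ i, S i ≠ 0 → S i = T i

/-- `B` is an exposed face of `K` in the inclusive sense: either `B = K` or `B` is the
set of maximizers over `K` of some linear functional. -/
def IsExposedFaceOf {d : ℕ} (K B : Set (Fin d → ℝ)) : Prop :=
  B = K ∨ ∃ c : Fin d → ℝ, B = {x ∈ K | ∀ y ∈ K, ∑ i, c i * y i ≤ ∑ i, c i * x i}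

/-- Maximizers of `c` over `K`. -/
def maxF {d : ℕ} (c : Fin d → ℝ) (K : Set (Fin d → ℝ)) : Set (Fin d → ℝ) :=
  {x ∈ K | ∀ y ∈ K, ∑ i, c i * y i ≤ ∑ i, c i * x i}

theorem exposed_iff {d : ℕ} (K B : Set (Fin d → ℝ)) :
    IsExposedFaceOf K B ↔ ∃ c, B = maxF c K := by
  constructor
  · rintro (h | h)
    · exact ⟨0, by simp [maxF, h]⟩
    · exact h
  · exact fun h => Or.inr h

theorem maxF_add {d : ℕ} (c : Fin d → ℝ) (K L : Set (Fin d → ℝ)) :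
    maxF c (K + L) = maxF c K + maxF c L := by
  have key : ∀ x y : Fin d → ℝ,
      ∑ i, c i * (x + y) i = ∑ i, c i * x i + ∑ i, c i * y i := by
    intro x y
    simp [mul_add, Finset.sum_add_distrib]
  ext x
  constructor
  · rintro ⟨⟨a, ha, b, hb, rfl⟩, h⟩
    refine ⟨a, ⟨ha, fun y hy => ?_⟩, b, ⟨hb, fun y hy => ?_⟩, rfl⟩
    · have := h (y + b) ⟨y, hy, b, hb, rfl⟩
      simp only [key] at this
      linarith
    · have := h (a + y) ⟨a, ha, y, hy, rfl⟩
      simp only [key] at this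
      linarith
  · rintro ⟨a, ⟨ha, ha2⟩, b, ⟨hb, hb2⟩, rfl⟩
    refine ⟨⟨a, ha, b, hb, rfl⟩, ?_⟩
    rintro _ ⟨y, hy, z, hz, rfl⟩
    simp only [key]
    exact add_le_add (ha2 y hy) (hb2 z hz)

theorem maxF_sdot {d : ℕ} (c : Fin d → ℝ) (S : Fin d → SignType) (K : Set (Fin d → ℝ)) :
    maxF c (sdot S K) = sdot S (maxF (fun i => c i * (S i : ℝ)) K) := by
  ext x
  constructor
  · rintro ⟨⟨a, ha, rfl⟩, h⟩
    refine ⟨a, ⟨ha, fun y hy => ?_⟩, rfl⟩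
    have := h _ ⟨y, hy, rfl⟩
    simpa only [mul_assoc] using this
  · rintro ⟨a, ⟨ha, h⟩, rfl⟩
    refine ⟨⟨a, ha, rfl⟩, ?_⟩
    rintro _ ⟨y, hy, rfl⟩
    have := h y hy
    simpa only [mul_assoc] using this

/-- The sign vector of the face of `□_S` exposed by `c`. -/
noncomputable def faceSign {d : ℕ} (c : Fin d → ℝ) (S : Fin d → SignType) : Fin d → SignType :=
  fun i => if S i = 0 then SignType.sign (c i) else S i

theorem svle_faceSign {d : ℕ} (c : Fin d → ℝ) (S : Fin d → SignType) :
    SVLe S (faceSign c S) := by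
  intro i hi
  simp [faceSign, hi]

theorem cubeFace_anti {d : ℕ} {S T : Fin d → SignType} (h : SVLe S T) :
    cubeFace T ⊆ cubeFace S := by
  rintro x ⟨h1, h2⟩
  refine ⟨h1, fun i hi => ?_⟩
  rw [h i hi]
  exact h2 i (by rw [← h i hi]; exact hi)

theorem cubeFace_term {d : ℕ} (c : Fin d → ℝ) (S : Fin d → SignType) {x y : Fin d → ℝ}
    (hx : x ∈ cubeFace (faceSign c S)) (hy : y ∈ cubeFace S) (i : Fin d) :
    c i * y i ≤ c i * x i := by
  by_cases hS : S i = 0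
  · by_cases hc : c i = 0
    · simp [hc]
    · have h1 : x i = (SignType.sign (c i) : ℝ) := by
        have := hx.2 i (by simp [faceSign, hS, hc])
        simpa [faceSign, hS] using this
      have h2 : c i * x i = |c i| := by
        rw [h1]
        exact self_mul_sign (c i)
      rw [h2]
      calc c i * y i ≤ |c i * y i| := le_abs_self _
        _ = |c i| * |y i| := abs_mul _ _
        _ ≤ |c i| * 1 := mul_le_mul_of_nonneg_left (hy.1 i) (abs_nonneg _)
        _ = |c i| := mul_one _
  · rw [hy.2 i hS, (cubeFace_anti (svle_faceSign c S) hx).2 i hS]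

theorem abs_sign_le (s : SignType) : |(s : ℝ)| ≤ 1 := by
  cases s <;> simp

theorem maxF_cubeFace {d : ℕ} (c : Fin d → ℝ) (S : Fin d → SignType) :
    maxF c (cubeFace S) = cubeFace (faceSign c S) := by
  ext x
  constructor
  · rintro ⟨hx, h⟩
    refine ⟨hx.1, fun i hi => ?_⟩
    set y : Fin d → ℝ :=
      fun i => if faceSign c S i = 0 then x i else (faceSign c S i : ℝ) with hy
    have hyT : y ∈ cubeFace (faceSign c S) := by
      refine ⟨fun j => ?_, fun j hj => by simp [hy, hj]⟩
      by_cases hj : faceSign c S j = 0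
      · simpa [hy, hj] using hx.1 j
      · simpa [hy, hj] using abs_sign_le (faceSign c S j)
    have hle := h y (cubeFace_anti (svle_faceSign c S) hyT)
    have hterm : ∀ j ∈ Finset.univ, c j * x j ≤ c j * y j :=
      fun j _ => cubeFace_term c S hyT hx j
    have heq := (Finset.sum_eq_sum_iff_of_le hterm).1
      (le_antisymm (Finset.sum_le_sum hterm) hle) i (Finset.mem_univ i)
    by_cases hS : S i = 0
    · have hc : c i ≠ 0 := by
        intro hc
        exact hi (by simp [faceSign, hS, hc])
      rw [mul_left_cancel₀ hc heq]
      simp [hy, hi]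
    · rw [hx.2 i hS]
      simp [faceSign, hS]
  · intro hx
    exact ⟨cubeFace_anti (svle_faceSign c S) hx,
      fun y hy => Finset.sum_le_sum fun i _ => cubeFace_term c S hx hy i⟩

theorem maxF_main {d : ℕ} (c : Fin d → ℝ) (S : Fin d → SignType) (K : Set (Fin d → ℝ)) :
    maxF c (cubeFace S + sdot S K) =
      cubeFace (faceSign c S) + sdot S (maxF (fun i => c i * (S i : ℝ)) K) := by
  rw [maxF_add, maxF_cubeFace, maxF_sdot]

theorem sign_cast_self (s : SignType) : SignType.sign (s : ℝ) = s := by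
  cases s <;> simp

theorem sign_sq {s : SignType} (h : s ≠ 0) : (s : ℝ) * (s : ℝ) = 1 := by
  cases s <;> simp at h ⊢

theorem statement19 {d : ℕ} (hd : 1 ≤ d) (S : Fin d → SignType) (hS : S ≠ 0)
    (σ : Set (Fin d → ℝ)) (hσsub : σ ⊆ cone S) (hσne : σ.Nonempty)
    (hσcpt : IsCompact σ) (hσcvx : Convex ℝ σ) (B : Set (Fin d → ℝ)) :
    (B.Nonempty ∧ IsExposedFaceOf (cubeFace S + sdot S σ) B) ↔
      (∃ T : Fin d → SignType, SVLe S T ∧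
        ∃ τ : Set (Fin d → ℝ), τ.Nonempty ∧ IsExposedFaceOf σ τ ∧
          B = cubeFace T + sdot S τ) := by
  simp only [exposed_iff]
  constructor
  · rintro ⟨hne, c, rfl⟩
    rw [maxF_main] at hne ⊢
    refine ⟨faceSign c S, svle_faceSign c S, _, ?_, ⟨_, rfl⟩, rfl⟩
    obtain ⟨_, _, _, _, ⟨t, ht, _⟩, _⟩ := hne
    exact ⟨t, ht⟩
  · rintro ⟨T, hT, τ, ⟨t, ht⟩, ⟨e, he⟩, rfl⟩
    refine ⟨⟨_, (fun i => (T i : ℝ)), ⟨fun i => abs_sign_le _, fun i _ => rfl⟩,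
      _, ⟨t, ht, rfl⟩, rfl⟩, fun i => if S i = 0 then (T i : ℝ) else e i * (S i : ℝ), ?_⟩
    rw [maxF_main]
    have h1 : faceSign (fun i => if S i = 0 then (T i : ℝ) else e i * (S i : ℝ)) S = T := by
      funext i
      by_cases hi : S i = 0
      · simp only [faceSign, hi, if_true]
        exact sign_cast_self _
      · simp only [faceSign, hi, if_false]
        exact hT i hi
    have h2 : ∀ x ∈ σ, ∑ i, (if S i = 0 then (T i : ℝ) else e i * (S i : ℝ)) * (S i : ℝ) * x i
        = ∑ i, e i * x i := by
      intro x hx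
      refine Finset.sum_congr rfl fun i _ => ?_
      by_cases hi : S i = 0
      · simp [(hσsub hx).2 i hi]
      · simp only [hi, if_false]
        rw [mul_assoc (e i), sign_sq hi, mul_one]
    rw [h1, he]
    congr 2
    ext x
    simp only [maxF, Set.mem_setOf_eq]
    refine and_congr_right fun hx => forall₂_congr fun y hy => ?_
    rw [h2 x hx, h2 y hy]
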